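/- Let $A$ be a connected algebraic ring over an algebraically closed field $K$. Then every left ideal and every right ideal of $A$ (as an abstract ring) is Zariski-closed and connected, and consequently $A$ is artinian as an abstract ring. -/

import Mathlib

noncomputable section

open MvPolynomial

/-- The Zariski topology on affine `n`-space over `K`. -/
def affineZariski (K : Type) [Field K] (n : ℕ) : TopologicalSpace (Fin n → K) :=
  TopologicalSpace.generateFrom
    {U | ∃ p : MvPolynomial (Fin n) K, U = {x | MvPolynomial.eval x p ≠ 0}}

/-- An algebraic ring over `K`: a Zariski-closed subset of some affine space `K^n`
equipped with regular (polynomial) addition, negation and multiplication maps making it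
into a unital ring whose additive group is a commutative algebraic group. -/
structure AlgebraicRing (K : Type) [Field K] where
  n : ℕ
  carrier : Set (Fin n → K)
  carrier_closed : ∃ S : Set (MvPolynomial (Fin n) K),
    carrier = {x | ∀ p ∈ S, MvPolynomial.eval x p = 0}
  add : (Fin n → K) → (Fin n → K) → Fin n → K
  mul : (Fin n → K) → (Fin n → K) → Fin n → K
  neg : (Fin n → K) → Fin n → K
  zero : Fin n → K
  one : Fin n → K
  add_poly : ∃ P : Fin n → MvPolynomial (Fin n ⊕ Fin n) K,
    ∀ x y : Fin n → K, ∀ i, add x y i = MvPolynomial.eval (Sum.elim x y) (P i)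
  mul_poly : ∃ P : Fin n → MvPolynomial (Fin n ⊕ Fin n) K,
    ∀ x y : Fin n → K, ∀ i, mul x y i = MvPolynomial.eval (Sum.elim x y) (P i)
  neg_poly : ∃ P : Fin n → MvPolynomial (Fin n) K,
    ∀ x : Fin n → K, ∀ i, neg x i = MvPolynomial.eval x (P i)
  zero_mem : zero ∈ carrier
  one_mem : one ∈ carrier
  add_mem : ∀ {x y}, x ∈ carrier → y ∈ carrier → add x y ∈ carrier
  mul_mem : ∀ {x y}, x ∈ carrier → y ∈ carrier → mul x y ∈ carrier
  neg_mem : ∀ {x}, x ∈ carrier → neg x ∈ carrier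
  add_comm' : ∀ x ∈ carrier, ∀ y ∈ carrier, add x y = add y x
  add_assoc' : ∀ x ∈ carrier, ∀ y ∈ carrier, ∀ z ∈ carrier,
    add (add x y) z = add x (add y z)
  zero_add' : ∀ x ∈ carrier, add zero x = x
  neg_add_cancel' : ∀ x ∈ carrier, add (neg x) x = zero
  mul_assoc' : ∀ x ∈ carrier, ∀ y ∈ carrier, ∀ z ∈ carrier,
    mul (mul x y) z = mul x (mul y z)
  one_mul' : ∀ x ∈ carrier, mul one x = x
  mul_one' : ∀ x ∈ carrier, mul x one = x
  left_distrib' : ∀ x ∈ carrier, ∀ y ∈ carrier, ∀ z ∈ carrier,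
    mul x (add y z) = add (mul x y) (mul x z)
  right_distrib' : ∀ x ∈ carrier, ∀ y ∈ carrier, ∀ z ∈ carrier,
    mul (add x y) z = add (mul x z) (mul y z)

namespace AlgebraicRing

variable {K : Type} [Field K] (A : AlgebraicRing K)

/-- The points of the algebraic ring `A`. -/
def Elt : Type := {x : Fin A.n → K // x ∈ A.carrier}

instance : TopologicalSpace A.Elt :=
  TopologicalSpace.induced (fun x => x.1) (affineZariski K A.n)

instance : Add A.Elt := ⟨fun x y => ⟨A.add x.1 y.1, A.add_mem x.2 y.2⟩⟩
instance : Mul A.Elt := ⟨fun x y => ⟨A.mul x.1 y.1, A.mul_mem x.2 y.2⟩⟩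
instance : Neg A.Elt := ⟨fun x => ⟨A.neg x.1, A.neg_mem x.2⟩⟩
instance : Zero A.Elt := ⟨⟨A.zero, A.zero_mem⟩⟩
instance : One A.Elt := ⟨⟨A.one, A.one_mem⟩⟩

instance : AddCommGroup A.Elt where
  add_assoc a b c := Subtype.ext (A.add_assoc' _ a.2 _ b.2 _ c.2)
  zero_add a := Subtype.ext (A.zero_add' _ a.2)
  add_zero a := Subtype.ext (by
    show A.add a.1 A.zero = a.1
    rw [A.add_comm' _ a.2 _ A.zero_mem]
    exact A.zero_add' _ a.2)
  neg_add_cancel a := Subtype.ext (A.neg_add_cancel' _ a.2)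
  add_comm a b := Subtype.ext (A.add_comm' _ a.2 _ b.2)
  nsmul := nsmulRec
  zsmul := zsmulRec

instance : Ring A.Elt :=
  { (inferInstance : AddCommGroup A.Elt) with
    left_distrib := fun a b c => Subtype.ext (A.left_distrib' _ a.2 _ b.2 _ c.2)
    right_distrib := fun a b c => Subtype.ext (A.right_distrib' _ a.2 _ b.2 _ c.2)
    zero_mul := fun a => by
      have h : (0 : A.Elt) * a + (0 : A.Elt) * a = (0 : A.Elt) * a + 0 := by
        rw [add_zero]
        apply Subtype.ext
        show A.add (A.mul A.zero a.1) (A.mul A.zero a.1) = A.mul A.zero a.1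
        rw [← A.right_distrib' _ A.zero_mem _ A.zero_mem _ a.2, A.zero_add' _ A.zero_mem]
      exact add_left_cancel h
    mul_zero := fun a => by
      have h : a * (0 : A.Elt) + a * (0 : A.Elt) = a * (0 : A.Elt) + 0 := by
        rw [add_zero]
        apply Subtype.ext
        show A.add (A.mul a.1 A.zero) (A.mul a.1 A.zero) = A.mul a.1 A.zero
        rw [← A.left_distrib' _ a.2 _ A.zero_mem _ A.zero_mem, A.zero_add' _ A.zero_mem]
      exact add_left_cancel h
    mul_assoc := fun a b c => Subtype.ext (A.mul_assoc' _ a.2 _ b.2 _ c.2)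
    one_mul := fun a => Subtype.ext (A.one_mul' _ a.2)
    mul_one := fun a => Subtype.ext (A.mul_one' _ a.2) }

end AlgebraicRing

/-- A commutative algebraic ring. -/
structure CommAlgebraicRing (K : Type) [Field K] extends AlgebraicRing K where
  mul_comm' : ∀ x ∈ carrier, ∀ y ∈ carrier, mul x y = mul y x

namespace CommAlgebraicRing

variable {K : Type} [Field K] (A : CommAlgebraicRing K)

/-- The points of the commutative algebraic ring `A`. -/
abbrev Elt : Type := A.toAlgebraicRing.Elt

instance : CommRing A.Elt :=
  { (inferInstance : Ring A.toAlgebraicRing.Elt) with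
    mul_comm := fun a b => Subtype.ext (by exact A.mul_comm' _ a.2 _ b.2) }

end CommAlgebraicRing

end


open PrimeSpectrum in
theorem aux_chev {K : Type} [Field K] [IsAlgClosed K] {σ τ : Type} [Finite σ] [Finite τ]
    (P : τ → MvPolynomial σ K) (I : Ideal (MvPolynomial σ K)) :
    ∃ D : ConstructibleSetData (MvPolynomial τ K), ∀ y : τ → K,
      (∃ x : σ → K, (∀ p ∈ I, MvPolynomial.eval x p = 0) ∧
        ∀ i, y i = MvPolynomial.eval x (P i)) ↔
      MvPolynomial.pointToPoint (k := K) y ∈ D.toSet := by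
  let φ : MvPolynomial τ K →ₐ[K] MvPolynomial σ K := MvPolynomial.bind₁ P
  have hev : ∀ (x : σ → K) (p : MvPolynomial τ K), MvPolynomial.eval x (φ p) =
      MvPolynomial.eval (fun i => MvPolynomial.eval x (P i)) p := by
    intro x p
    induction p using MvPolynomial.induction_on with
    | C a => simp [φ]
    | add p q hp hq => simp [hp, hq]
    | mul_X p i hp => simp [hp]; left; simp [φ]
  have hfp : φ.toRingHom.FinitePresentation := by
    have : φ.FinitePresentation := AlgHom.FinitePresentation.of_finiteType.mp <| by
      apply AlgHom.FiniteType.of_comp_finiteType (f := Algebra.ofId K _)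
      have : φ.comp (Algebra.ofId K _) = Algebra.ofId K _ := by ext
      rw [this]
      have h : Algebra.FiniteType K (MvPolynomial σ K) := inferInstance
      change (algebraMap K (MvPolynomial σ K)).FiniteType
      exact RingHom.finiteType_algebraMap.mpr h
    exact this
  have hI : Topology.IsConstructible (zeroLocus (I : Set (MvPolynomial σ K))) := by
    rw [← Topology.isConstructible_compl]
    apply IsCompact.isConstructible
    · exact TopologicalSpace.NoetherianSpace.isCompact _
    · exact (isClosed_zeroLocus _).isOpen_compl
  obtain ⟨D, hD⟩ := exists_constructibleSetData_iff.mpr (isConstructible_comap_image hfp hI)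
  refine ⟨D, fun y => ?_⟩
  rw [hD]
  constructor
  · rintro ⟨x, hx, hy⟩
    refine ⟨MvPolynomial.pointToPoint (k := K) x, ?_, ?_⟩
    · intro p hp
      change p ∈ MvPolynomial.vanishingIdeal K {x}
      rw [MvPolynomial.mem_vanishingIdeal_singleton_iff]
      simpa [MvPolynomial.aeval_eq_eval] using hx p hp
    · ext p
      change φ p ∈ MvPolynomial.vanishingIdeal K {x} ↔ p ∈ MvPolynomial.vanishingIdeal K {y}
      rw [MvPolynomial.mem_vanishingIdeal_singleton_iff,
        MvPolynomial.mem_vanishingIdeal_singleton_iff]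
      have : y = (fun i => MvPolynomial.eval x (P i)) := funext hy
      simp only [MvPolynomial.aeval_eq_eval, RingHom.coe_coe]
      rw [hev, this]
  · rintro ⟨q, hq, hqy⟩
    obtain ⟨m, hm, hqm⟩ := q.asIdeal.exists_le_maximal q.2.ne_top
    obtain ⟨x, rfl⟩ := MvPolynomial.eq_vanishingIdeal_singleton_of_isMaximal K hm
    refine ⟨x, fun p hp => ?_, fun i => ?_⟩
    · have := hqm (hq hp)
      rw [MvPolynomial.mem_vanishingIdeal_singleton_iff] at this
      simpa [MvPolynomial.aeval_eq_eval] using this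
    · have h1 : (MvPolynomial.X i - MvPolynomial.C (y i) : MvPolynomial τ K) ∈
          (MvPolynomial.pointToPoint (k := K) y).asIdeal := by
        change _ ∈ MvPolynomial.vanishingIdeal K {y}
        rw [MvPolynomial.mem_vanishingIdeal_singleton_iff]
        simp
      rw [← hqy] at h1
      have h2 := hqm (show φ _ ∈ q.asIdeal from h1)
      rw [MvPolynomial.mem_vanishingIdeal_singleton_iff] at h2
      simp only [MvPolynomial.aeval_eq_eval, RingHom.coe_coe] at h2
      rw [hev] at h2
      simp at h2
      exact (sub_eq_zero.mp h2).symm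

theorem aux_irr_of_conn {X : Type} [TopologicalSpace X] [TopologicalSpace.NoetherianSpace X]
    [ConnectedSpace X] (hom : ∀ x y : X, ∃ f : X ≃ₜ X, f x = y) :
    IsIrreducible (Set.univ : Set X) := by
  obtain ⟨x0⟩ : Nonempty X := inferInstance
  set Z := irreducibleComponent x0
  have hZ : Z ∈ irreducibleComponents X := irreducibleComponent_mem_irreducibleComponents x0
  obtain ⟨o, ho, ⟨z, hz⟩, hoZ⟩ :=
    TopologicalSpace.NoetherianSpace.exists_isOpen_nonempty_subset_irreducibleComponent Z hZ
  have hoi : IsPreirreducible o := hZ.1.2.open_subset ho hoZ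
  have hcl : IsClosed Z := isClosed_irreducibleComponent
  have hop : IsOpen Z := by
    rw [isOpen_iff_forall_mem_open]
    intro x hx
    obtain ⟨f, hf⟩ := hom z x
    refine ⟨f '' o, ?_, f.isOpenMap _ ho, ⟨z, hz, hf⟩⟩
    have hV : IsIrreducible (f '' o) :=
      ⟨⟨_, z, hz, rfl⟩, hoi.image _ f.continuous.continuousOn⟩
    have h1 : Z ⊆ closure (f '' o) := by
      have := subset_closure_inter_of_isPreirreducible_of_isOpen hZ.1.2 (f.isOpenMap _ ho)
        ⟨x, hx, ⟨z, hz, hf⟩⟩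
      exact this.trans (closure_mono Set.inter_subset_right)
    exact subset_closure.trans (hZ.2 hV.closure h1)
  have : Z = Set.univ := IsClopen.eq_univ ⟨hcl, hop⟩ ⟨x0, mem_irreducibleComponent⟩
  rw [← this]
  exact hZ.1

namespace AlgebraicRing

theorem aux_eval_bind {K : Type} [Field K] {σ τ : Type} (P : τ → MvPolynomial σ K) (x : σ → K)
    (p : MvPolynomial τ K) : MvPolynomial.eval x (MvPolynomial.bind₁ P p) =
      MvPolynomial.eval (fun i => MvPolynomial.eval x (P i)) p := by
  induction p using MvPolynomial.induction_on with
  | C a => simp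
  | add p q hp hq => simp [hp, hq]
  | mul_X p i hp => simp [hp]

variable {K : Type} [Field K] (A : AlgebraicRing K)

def spt (x : A.Elt) : PrimeSpectrum (MvPolynomial (Fin A.n) K) :=
  MvPolynomial.pointToPoint (k := K) x.1

theorem mem_spt (x : A.Elt) (p : MvPolynomial (Fin A.n) K) :
    p ∈ (A.spt x).asIdeal ↔ MvPolynomial.eval x.1 p = 0 := by
  change p ∈ MvPolynomial.vanishingIdeal K {x.1} ↔ _
  rw [MvPolynomial.mem_vanishingIdeal_singleton_iff]
  simp [MvPolynomial.aeval_eq_eval]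

theorem spt_inducing : Topology.IsInducing A.spt := by
  constructor
  rw [PrimeSpectrum.isTopologicalBasis_basic_opens.eq_generateFrom, induced_generateFrom_eq]
  change TopologicalSpace.induced _ (affineZariski K A.n) = _
  rw [affineZariski, induced_generateFrom_eq]
  congr 1
  ext U
  constructor
  · rintro ⟨_, ⟨p, rfl⟩, rfl⟩
    refine ⟨_, ⟨p, rfl⟩, ?_⟩
    ext x
    exact not_congr (A.mem_spt x p)
  · rintro ⟨_, ⟨p, rfl⟩, rfl⟩
    refine ⟨_, ⟨p, rfl⟩, ?_⟩
    ext x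
    exact (not_congr (A.mem_spt x p)).symm

instance : TopologicalSpace.NoetherianSpace A.Elt := A.spt_inducing.noetherianSpace

theorem closed_iff {J : Set A.Elt} : IsClosed J ↔ ∃ S : Set (MvPolynomial (Fin A.n) K),
    J = {x | ∀ p ∈ S, MvPolynomial.eval x.1 p = 0} := by
  rw [A.spt_inducing.isClosed_iff]
  constructor
  · rintro ⟨t, ht, rfl⟩
    obtain ⟨S, rfl⟩ := (PrimeSpectrum.isClosed_iff_zeroLocus _).mp ht
    refine ⟨S, ?_⟩
    ext x
    exact forall₂_congr fun p _ => A.mem_spt x p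
  · rintro ⟨S, rfl⟩
    refine ⟨_, PrimeSpectrum.isClosed_zeroLocus S, ?_⟩
    ext x
    exact forall₂_congr fun p _ => A.mem_spt x p

def IsPoly (f : A.Elt → A.Elt) : Prop :=
  ∃ P : Fin A.n → MvPolynomial (Fin A.n) K, ∀ x i, (f x).1 i = MvPolynomial.eval x.1 (P i)

variable {A}

theorem IsPoly.continuous {f : A.Elt → A.Elt} (hf : A.IsPoly f) : Continuous f := by
  obtain ⟨P, hP⟩ := hf
  rw [continuous_iff_isClosed]
  intro s hs
  obtain ⟨S, rfl⟩ := A.closed_iff.mp hs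
  refine A.closed_iff.mpr ⟨MvPolynomial.bind₁ P '' S, ?_⟩
  ext x
  simp only [Set.preimage_ofPred_eq, Set.mem_ofPred_eq, Set.forall_mem_image, aux_eval_bind]
  have : (f x).1 = fun i => MvPolynomial.eval x.1 (P i) := funext (hP x)
  rw [this]

theorem IsPoly.add_left (a : A.Elt) : A.IsPoly (fun x => a + x) := by
  obtain ⟨P, hP⟩ := A.add_poly
  refine ⟨fun i => MvPolynomial.bind₁ (Sum.elim (fun j => MvPolynomial.C (a.1 j)) MvPolynomial.X)
    (P i), fun x i => ?_⟩
  rw [aux_eval_bind]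
  refine (hP a.1 x.1 i).trans ?_
  congr 2
  ext (j | j) <;> simp

theorem IsPoly.mul_left (a : A.Elt) : A.IsPoly (fun x => a * x) := by
  obtain ⟨P, hP⟩ := A.mul_poly
  refine ⟨fun i => MvPolynomial.bind₁ (Sum.elim (fun j => MvPolynomial.C (a.1 j)) MvPolynomial.X)
    (P i), fun x i => ?_⟩
  rw [aux_eval_bind]
  refine (hP a.1 x.1 i).trans ?_
  congr 2
  ext (j | j) <;> simp

theorem IsPoly.mul_right (a : A.Elt) : A.IsPoly (fun x => x * a) := by
  obtain ⟨P, hP⟩ := A.mul_poly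
  refine ⟨fun i => MvPolynomial.bind₁ (Sum.elim MvPolynomial.X (fun j => MvPolynomial.C (a.1 j)))
    (P i), fun x i => ?_⟩
  rw [aux_eval_bind]
  refine (hP x.1 a.1 i).trans ?_
  congr 2
  ext (j | j) <;> simp

theorem IsPoly.neg : A.IsPoly (fun x => -x) := by
  obtain ⟨P, hP⟩ := A.neg_poly
  exact ⟨P, fun x i => hP x.1 i⟩

theorem cont_add_left (a : A.Elt) : Continuous (fun x : A.Elt => a + x) :=
  (IsPoly.add_left a).continuous

theorem cont_add_right (a : A.Elt) : Continuous (fun x : A.Elt => x + a) := by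
  simpa only [add_comm] using (IsPoly.add_left a).continuous

theorem cont_sub_left (a : A.Elt) : Continuous (fun x : A.Elt => a - x) := by
  simp only [sub_eq_add_neg]
  exact (cont_add_left a).comp IsPoly.neg.continuous

theorem cont_sub_right (a : A.Elt) : Continuous (fun x : A.Elt => x - a) := by
  simpa only [sub_eq_add_neg] using cont_add_right (-a)

theorem irr_univ [ConnectedSpace A.Elt] : IsIrreducible (Set.univ : Set A.Elt) := by
  apply aux_irr_of_conn
  intro x y
  let e : A.Elt ≃ₜ A.Elt :=
    { toFun := fun z => (y - x) + z
      invFun := fun z => -(y - x) + z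
      left_inv := fun z => neg_add_cancel_left _ _
      right_inv := fun z => add_neg_cancel_left _ _
      continuous_toFun := cont_add_left _
      continuous_invFun := cont_add_left _ }
  exact ⟨e, sub_add_cancel y x⟩

theorem irr_add {S T : Set A.Elt} (hS : IsIrreducible S) (hT : IsIrreducible T) :
    IsIrreducible {z | ∃ s ∈ S, ∃ t ∈ T, z = s + t} := by
  obtain ⟨s0, hs0⟩ := hS.1
  obtain ⟨t0, ht0⟩ := hT.1
  refine ⟨⟨_, s0, hs0, t0, ht0, rfl⟩, ?_⟩
  rintro U V hU hV ⟨_, ⟨s1, hs1, t1, ht1, rfl⟩, hU1⟩ ⟨_, ⟨s2, hs2, t2, ht2, rfl⟩, hV2⟩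
  obtain ⟨s, hs, hsU, hsV⟩ := hS.2 _ _ (hU.preimage (cont_add_right t1))
    (hV.preimage (cont_add_right t2)) ⟨s1, hs1, hU1⟩ ⟨s2, hs2, hV2⟩
  obtain ⟨t, ht, htU, htV⟩ := hT.2 _ _ (hU.preimage (cont_add_left s))
    (hV.preimage (cont_add_left s)) ⟨t1, ht1, hsU⟩ ⟨t2, ht2, hsV⟩
  exact ⟨_, ⟨s, hs, t, ht, rfl⟩, htU, htV⟩

theorem exists_open {H : Set A.Elt} (hH : IsIrreducible H)
    (D : PrimeSpectrum.ConstructibleSetData (MvPolynomial (Fin A.n) K))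
    (hD : ∀ x, x ∈ H ↔ A.spt x ∈ D.toSet) :
    ∃ W : Set A.Elt, IsOpen W ∧ (W ∩ H).Nonempty ∧ W ∩ closure H ⊆ H := by
  classical
  let F := fun C : PrimeSpectrum.BasicConstructibleSetData (MvPolynomial (Fin A.n) K) =>
    closure (A.spt ⁻¹' C.toSet)
  have := (isIrreducible_iff_sUnion_isClosed.mp hH) (D.image F) (by
    intro z hz
    obtain ⟨C, _, rfl⟩ := Finset.mem_image.mp hz
    exact isClosed_closure) (by
    intro x hx
    have h := (hD x).mp hx
    simp only [PrimeSpectrum.ConstructibleSetData.toSet, Set.mem_iUnion] at h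
    obtain ⟨C, hC, hx'⟩ := h
    exact ⟨F C, by simpa using ⟨C, hC, rfl⟩, subset_closure hx'⟩)
  obtain ⟨z, hz, hHz⟩ := this
  obtain ⟨C, hC, rfl⟩ := Finset.mem_image.mp hz
  have hCH : A.spt ⁻¹' C.toSet ⊆ H := by
    intro x hx
    rw [hD]
    exact Set.mem_biUnion hC hx
  refine ⟨A.spt ⁻¹' (PrimeSpectrum.zeroLocus {C.f})ᶜ,
    (PrimeSpectrum.isClosed_zeroLocus _).isOpen_compl.preimage A.spt_inducing.continuous, ?_, ?_⟩
  · obtain ⟨h, hh⟩ := hH.1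
    obtain ⟨y, hy⟩ := closure_nonempty_iff.mp ⟨h, hHz hh⟩
    exact ⟨y, hy.2, hCH hy⟩
  · rintro x ⟨hx1, hx2⟩
    apply hCH
    refine ⟨?_, hx1⟩
    have h1 : closure H ⊆ A.spt ⁻¹' (PrimeSpectrum.zeroLocus (Set.range C.g)) := by
      refine (closure_minimal hHz isClosed_closure).trans (closure_minimal ?_ ?_)
      · exact fun y hy => hy.1
      · exact (PrimeSpectrum.isClosed_zeroLocus _).preimage A.spt_inducing.continuous
    exact h1 hx2

theorem closed_of_open {H : AddSubgroup A.Elt} {W : Set A.Elt} (hW : IsOpen W)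
    (hne : (W ∩ H).Nonempty) (hsub : W ∩ closure (H : Set A.Elt) ⊆ H) :
    IsClosed (H : Set A.Elt) := by
  apply isClosed_of_closure_subset
  intro x hx
  obtain ⟨w, hwW, hwH⟩ := hne
  have key : ∀ h ∈ H, ∀ y ∈ closure (H : Set A.Elt), y - h ∈ closure (H : Set A.Elt) := by
    intro h hh y hy
    exact map_mem_closure (f := fun z => z - h) (cont_sub_right h) hy (fun z hz => H.sub_mem hz hh)
  have h1 := key w hwH x hx
  obtain ⟨u, huW, huH⟩ := mem_closure_iff.mp h1 _ (hW.preimage (cont_sub_left x))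
    (by simpa using hwW)
  have h2 := hsub ⟨huW, key u huH x hx⟩
  simpa using H.add_mem h2 huH

theorem closed_sup [IsAlgClosed K] [ConnectedSpace A.Elt] (J : AddSubgroup A.Elt)
    (hJ : IsClosed (J : Set A.Elt)) (hJi : IsIrreducible (J : Set A.Elt))
    (f : A.Elt →+ A.Elt) (hf : A.IsPoly f) :
    IsClosed ((J ⊔ f.range : AddSubgroup A.Elt) : Set A.Elt) ∧
      IsIrreducible ((J ⊔ f.range : AddSubgroup A.Elt) : Set A.Elt) := by
  have hset : ((J ⊔ f.range : AddSubgroup A.Elt) : Set A.Elt) =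
      {z | ∃ s ∈ (J : Set A.Elt), ∃ t ∈ f '' Set.univ, z = s + t} := by
    ext z
    simp only [SetLike.mem_coe, AddSubgroup.mem_sup, Set.mem_ofPred_eq]
    constructor
    · rintro ⟨s, hs, _, ⟨t, rfl⟩, rfl⟩
      exact ⟨s, hs, _, ⟨t, trivial, rfl⟩, rfl⟩
    · rintro ⟨s, hs, _, ⟨t, -, rfl⟩, rfl⟩
      exact ⟨s, hs, _, ⟨t, rfl⟩, rfl⟩
  have hirr : IsIrreducible ((J ⊔ f.range : AddSubgroup A.Elt) : Set A.Elt) := by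
    rw [hset]
    exact irr_add hJi (irr_univ.image _ hf.continuous.continuousOn)
  refine ⟨?_, hirr⟩
  obtain ⟨S, hS⟩ := A.closed_iff.mp hJ
  obtain ⟨SA, hSA⟩ := A.carrier_closed
  obtain ⟨Pf, hPf⟩ := hf
  obtain ⟨Pa, hPa⟩ := A.add_poly
  let P : Fin A.n → MvPolynomial (Fin A.n ⊕ Fin A.n) K := fun i =>
    MvPolynomial.bind₁ (Sum.elim (fun j => MvPolynomial.X (Sum.inl j))
      (fun j => MvPolynomial.rename Sum.inr (Pf j))) (Pa i)
  let I : Ideal (MvPolynomial (Fin A.n ⊕ Fin A.n) K) := Ideal.span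
    (MvPolynomial.rename Sum.inl '' (S ∪ SA) ∪ MvPolynomial.rename Sum.inr '' SA)
  have hI : ∀ x : Fin A.n ⊕ Fin A.n → K, (∀ p ∈ I, MvPolynomial.eval x p = 0) ↔
      ((∀ p ∈ S, MvPolynomial.eval (x ∘ Sum.inl) p = 0) ∧ x ∘ Sum.inl ∈ A.carrier) ∧
        x ∘ Sum.inr ∈ A.carrier := by
    intro x
    have h1 : (∀ p ∈ I, MvPolynomial.eval x p = 0) ↔ I ≤ RingHom.ker (MvPolynomial.eval x) :=
      Iff.rfl
    rw [h1, Ideal.span_le, Set.union_subset_iff, Set.image_subset_iff, Set.image_subset_iff,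
      Set.union_subset_iff]
    have h2 : ∀ z : Fin A.n → K, z ∈ A.carrier ↔ ∀ p ∈ SA, MvPolynomial.eval z p = 0 := by
      intro z
      conv_lhs => rw [hSA]
      rfl
    rw [h2, h2]
    simp only [Set.subset_def, Set.mem_preimage, SetLike.mem_coe, RingHom.mem_ker,
      MvPolynomial.eval_rename]
  obtain ⟨D, hD⟩ := aux_chev P I
  obtain ⟨W, hW, hne, hsub⟩ := exists_open hirr D (by
    intro z
    refine Iff.trans ?_ (hD z.1)
    rw [hset]
    have hPx : ∀ (s t : A.Elt) (i), MvPolynomial.eval (Sum.elim s.1 t.1) (P i) =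
        (s + f t).1 i := by
      intro s t i
      refine Eq.trans ?_ (hPa _ _ i).symm
      simp only [P, aux_eval_bind]
      congr 2
      ext (j | j)
      · simp
      · simp [MvPolynomial.eval_rename, hPf]
    constructor
    · rintro ⟨s, hs, _, ⟨t, -, rfl⟩, rfl⟩
      have hs' := hs
      rw [hS] at hs'
      refine ⟨Sum.elim s.1 t.1, (hI _).mpr ⟨⟨hs', s.2⟩, t.2⟩, fun i => ?_⟩
      rw [hPx s t]
    · rintro ⟨x, hx, hz⟩
      obtain ⟨⟨hxS, hl⟩, hr⟩ := (hI x).mp hx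
      refine ⟨⟨x ∘ Sum.inl, hl⟩, ?_, _, ⟨⟨x ∘ Sum.inr, hr⟩, trivial, rfl⟩, ?_⟩
      · rw [hS]; exact hxS
      · apply Subtype.ext
        funext i
        rw [hz i, ← hPx ⟨x ∘ Sum.inl, hl⟩ ⟨x ∘ Sum.inr, hr⟩]
        simp only [Sum.elim_comp_inl_inr])
  exact closed_of_open hW hne hsub

theorem closed_singleton (a : A.Elt) : IsClosed ({a} : Set A.Elt) := by
  refine A.closed_iff.mpr ⟨Set.range fun i => MvPolynomial.X i - MvPolynomial.C (a.1 i), ?_⟩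
  ext x
  simp only [Set.mem_singleton_iff, Set.mem_ofPred_eq, Set.forall_mem_range, map_sub,
    MvPolynomial.eval_X, MvPolynomial.eval_C, sub_eq_zero]
  exact ⟨fun h i => by rw [h], fun h => Subtype.ext (funext h)⟩

theorem main_aux [IsAlgClosed K] [ConnectedSpace A.Elt] (I : AddSubgroup A.Elt)
    (hI : ∀ a ∈ I, ∃ f : A.Elt →+ A.Elt, A.IsPoly f ∧ a ∈ f.range ∧ f.range ≤ I) :
    IsClosed (I : Set A.Elt) ∧ IsIrreducible (I : Set A.Elt) := by
  let T := {J : AddSubgroup A.Elt //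
    IsClosed (J : Set A.Elt) ∧ IsIrreducible (J : Set A.Elt) ∧ J ≤ I}
  let v : T → Ideal (MvPolynomial (Fin A.n) K) := fun J =>
    PrimeSpectrum.vanishingIdeal (A.spt '' (J.1 : Set A.Elt))
  have hv : ∀ J, (v J).IsPrime := fun J =>
    PrimeSpectrum.isIrreducible_iff_vanishingIdeal_isPrime.mp
      (J.2.2.1.image _ A.spt_inducing.continuous.continuousOn)
  let J0 : T := ⟨⊥, by simpa using closed_singleton (0 : A.Elt),
    by simpa using isIrreducible_singleton, bot_le⟩
  obtain ⟨J, hJ⟩ : ∃ J : T, ∀ J' : T, (v J).height ≤ (v J').height := by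
    have hne : (Set.range fun J : T => (v J).height).Nonempty := ⟨_, J0, rfl⟩
    obtain ⟨_, ⟨J, rfl⟩, hm⟩ := WellFounded.has_min (wellFounded_lt (α := ℕ∞)) _ hne
    exact ⟨J, fun J' => not_lt.mp (hm _ ⟨J', rfl⟩)⟩
  have hIJ : I = J.1 := by
    refine le_antisymm (fun a ha => ?_) J.2.2.2
    obtain ⟨f, hf, haf, hfI⟩ := hI a ha
    obtain ⟨hc, hi⟩ := closed_sup J.1 J.2.1 J.2.2.1 f hf
    let J' : T := ⟨J.1 ⊔ f.range, hc, hi, sup_le J.2.2.2 hfI⟩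
    have hle : v J' ≤ v J := PrimeSpectrum.vanishingIdeal_anti_mono
      (Set.image_mono (show J.1 ≤ J.1 ⊔ f.range from le_sup_left))
    have heq : v J' = v J := by
      have := hv J'
      have := hv J
      by_contra hne
      exact absurd (hJ J') (not_le.mpr
        (Ideal.height_strict_mono_of_isPrime (lt_of_le_of_ne hle hne)))
    have ha' : a ∈ J'.1 := (le_sup_right : f.range ≤ J.1 ⊔ f.range) haf
    have hcl : A.spt a ∈ closure (A.spt '' (J.1 : Set A.Elt)) := by
      rw [← PrimeSpectrum.zeroLocus_vanishingIdeal_eq_closure]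
      change (v J : Set (MvPolynomial (Fin A.n) K)) ⊆ _
      rw [← heq]
      exact PrimeSpectrum.subset_zeroLocus_vanishingIdeal _ ⟨a, ha', rfl⟩
    have h3 : a ∈ closure (J.1 : Set A.Elt) := by
      rw [A.spt_inducing.closure_eq_preimage_closure_image]
      exact hcl
    rwa [J.2.1.closure_eq] at h3
  rw [hIJ]
  exact ⟨J.2.1, J.2.2.1⟩

end AlgebraicRing

/-- In a connected algebraic ring over an algebraically closed field, every
left ideal and every right ideal of the abstract ring is Zariski-closed and connected, and
consequently the ring is artinian. -/
theorem stmt_6 (K : Type) [Field K] [IsAlgClosed K] (A : AlgebraicRing K)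
    [ConnectedSpace A.Elt] :
    (∀ I : Set A.Elt, (0 : A.Elt) ∈ I → (∀ a ∈ I, ∀ b ∈ I, a + b ∈ I) →
      ((∀ r : A.Elt, ∀ a ∈ I, r * a ∈ I) ∨ (∀ r : A.Elt, ∀ a ∈ I, a * r ∈ I)) →
      IsClosed I ∧ IsConnected I) ∧
    IsArtinianRing A.Elt := by
  have main : ∀ I : Set A.Elt, (0 : A.Elt) ∈ I → (∀ a ∈ I, ∀ b ∈ I, a + b ∈ I) →
      ((∀ r : A.Elt, ∀ a ∈ I, r * a ∈ I) ∨ (∀ r : A.Elt, ∀ a ∈ I, a * r ∈ I)) →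
      IsClosed I ∧ IsConnected I := by
    intro I h0 hadd hid
    let I' : AddSubgroup A.Elt :=
      { carrier := I
        zero_mem' := h0
        add_mem' := fun {a b} ha hb => hadd a ha b hb
        neg_mem' := fun {a} ha => by
          rcases hid with h | h
          · simpa using h (-1) a ha
          · simpa using h (-1) a ha }
    have := AlgebraicRing.main_aux I' (by
      intro a ha
      rcases hid with h | h
      · refine ⟨AddMonoidHom.mulRight a, AlgebraicRing.IsPoly.mul_right a, ⟨1, by simp⟩, ?_⟩
        rintro _ ⟨r, rfl⟩
        exact h r a ha
      · refine ⟨AddMonoidHom.mulLeft a, AlgebraicRing.IsPoly.mul_left a, ⟨1, by simp⟩, ?_⟩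
        rintro _ ⟨r, rfl⟩
        exact h r a ha)
    exact ⟨this.1, this.2.isConnected⟩
  refine ⟨main, ?_⟩
  let g : Ideal A.Elt → TopologicalSpace.Closeds A.Elt := fun I =>
    ⟨(I : Set A.Elt), (main I I.zero_mem (fun a ha b hb => I.add_mem ha hb)
      (Or.inl fun r a ha => I.mul_mem_left r ha)).1⟩
  have hg : StrictMono g := fun I J h => h
  exact ⟨hg.wellFoundedLT.wf⟩
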